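/- There exist a compact Hausdorff space K and a bounded linear operator T : C(K, ℓ₁) → ℓ₂ for which the induced operator T# : C(K) → L(ℓ₁, ℓ₂) is not 2-summing (each T# f is 1-summing, since every bounded operator from ℓ₁ to ℓ₂ is 1-summing, but T# : C(K) → Π₁(ℓ₁, ℓ₂) fails to be 2-summing). -/

import Mathlib

set_option maxHeartbeats 1000000
set_option synthInstance.maxHeartbeats 400000

noncomputable section

open scoped BigOperators NNReal ENNReal
open NormedSpace

/-- The scalar field. -/
notation "𝕂" => ℝ
section Summing

variable {E F : Type} [NormedAddCommGroup E] [NormedSpace 𝕂 E]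
  [NormedAddCommGroup F] [NormedSpace 𝕂 F]

/-- The weak ℓ_q norm of a finite family of vectors:
`sup { (Σ_i ‖e*(e_i)‖^q)^(1/q) : e* ∈ E*, ‖e*‖ ≤ 1 }`. -/
def weakNorm (q : ℝ) {n : ℕ} (e : Fin n → E) : ℝ :=
  ⨆ f : {f : StrongDual 𝕂 E // ‖f‖ ≤ 1}, (∑ i, ‖(f : StrongDual 𝕂 E) (e i)‖ ^ q) ^ (1 / q)

/-- `T` satisfies the (p,q)-summing inequality with constant `C`:
`(Σ_i ‖T e_i‖^p)^(1/p) ≤ C · sup { (Σ_i ‖e*(e_i)‖^q)^(1/q) : ‖e*‖ ≤ 1 }`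
for all finite families `e_1, …, e_n`. -/
def SummingWithC (p q C : ℝ) (T : E →L[𝕂] F) : Prop :=
  ∀ (n : ℕ) (e : Fin n → E),
    (∑ i, ‖T (e i)‖ ^ p) ^ (1 / p) ≤ C * weakNorm q e

/-- `T` is (p,q)-summing. -/
def IsPQSumming (p q : ℝ) (T : E →L[𝕂] F) : Prop :=
  ∃ C, 0 ≤ C ∧ SummingWithC p q C T

/-- `T` is p-summing. -/
def IsPSumming (p : ℝ) (T : E →L[𝕂] F) : Prop := IsPQSumming p p T

/-- The p-summing norm `π_p(T)`: the least admissible constant. -/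
def pNorm (p : ℝ) (T : E →L[𝕂] F) : ℝ :=
  sInf {C | 0 ≤ C ∧ SummingWithC p p C T}

end Summing

/-- For `f : C(Ω, 𝕂)` and a vector `y`, the function `f ⊗ y : t ↦ f(t) • y`, under the
identification `C(Ω) ⊗̂_ε H = C(Ω, H)`. -/
def cmSmul {Ω : Type} [TopologicalSpace Ω] {H : Type} [NormedAddCommGroup H]
    [NormedSpace 𝕂 H] (f : C(Ω, 𝕂)) (y : H) : C(Ω, H) :=
  ⟨fun t => f t • y, (map_continuous f).smul continuous_const⟩

section Helpers
open Finset Filter Topology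
def sg (A : Finset ℕ) (i : ℕ) : ℝ := if i ∈ A then 1 else -1

lemma sg_abs (A : Finset ℕ) (i : ℕ) : |sg A i| = 1 := by
  unfold sg; split_ifs <;> simp

lemma sg_insert_of_lt (A : Finset ℕ) {i n : ℕ} (h : i < n) : sg (insert n A) i = sg A i := by
  unfold sg
  have : i ≠ n := by omega
  simp [this]

def rX (a : ℕ → ℝ) (n : ℕ) (A : Finset ℕ) : ℝ := ∑ i ∈ range n, sg A i * a i

lemma rX_succ_mem (a : ℕ → ℝ) (n : ℕ) (A : Finset ℕ) :
    rX a (n+1) (insert n A) = rX a n A + a n := by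
  unfold rX
  rw [sum_range_succ]
  congr 1
  · exact sum_congr rfl fun i hi => by rw [sg_insert_of_lt A (mem_range.1 hi)]
  · simp [sg]

lemma rX_succ_not (a : ℕ → ℝ) (n : ℕ) (A : Finset ℕ) (hA : A ∈ (range n).powerset) :
    rX a (n+1) A = rX a n A - a n := by
  unfold rX
  rw [sum_range_succ]
  have : n ∉ A := fun h => by simpa using mem_powerset.1 hA h
  simp [sg, this, sub_eq_add_neg]

lemma pow_sum_succ (F : Finset ℕ → ℝ) (n : ℕ) :
    ∑ A ∈ (range (n+1)).powerset, F A
      = ∑ A ∈ (range n).powerset, (F A + F (insert n A)) := by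
  rw [range_add_one, sum_powerset_insert (by simp), sum_add_distrib]

lemma rX_moment2 (a : ℕ → ℝ) (n : ℕ) :
    ∑ A ∈ (range n).powerset, rX a n A ^ 2 = 2 ^ n * ∑ i ∈ range n, a i ^ 2 := by
  induction n with
  | zero => simp [rX]
  | succ n ih =>
    rw [pow_sum_succ, sum_range_succ]
    have : ∀ A ∈ (range n).powerset, rX a (n+1) A ^ 2 + rX a (n+1) (insert n A) ^ 2
        = 2 * rX a n A ^ 2 + 2 * a n ^ 2 := fun A hA => by
      rw [rX_succ_mem, rX_succ_not a n A hA]; ring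
    rw [sum_congr rfl this, sum_add_distrib, ← mul_sum, ih]
    simp; ring

lemma rX_moment4 (a : ℕ → ℝ) (n : ℕ) :
    ∑ A ∈ (range n).powerset, rX a n A ^ 4 ≤ 3 * 2 ^ n * (∑ i ∈ range n, a i ^ 2) ^ 2 := by
  induction n with
  | zero => simp [rX]
  | succ n ih =>
    rw [pow_sum_succ, sum_range_succ]
    have : ∀ A ∈ (range n).powerset, rX a (n+1) A ^ 4 + rX a (n+1) (insert n A) ^ 4
        = 2 * rX a n A ^ 4 + 12 * a n ^ 2 * rX a n A ^ 2 + 2 * a n ^ 4 := fun A hA => by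
      rw [rX_succ_mem, rX_succ_not a n A hA]; ring
    rw [sum_congr rfl this, sum_add_distrib, sum_add_distrib, ← mul_sum, ← mul_sum, rX_moment2]
    simp only [sum_const, card_powerset, card_range, nsmul_eq_mul, Nat.cast_pow, Nat.cast_ofNat]
    have h2 : (0:ℝ) ≤ 2 ^ n * a n ^ 4 := by positivity
    rw [pow_succ (2:ℝ)]
    nlinarith

lemma khinchine (a : ℕ → ℝ) (n : ℕ) :
    2 ^ n * √(∑ i ∈ range n, a i ^ 2) ≤ 4 * ∑ A ∈ (range n).powerset, |rX a n A| := by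
  set s := √(∑ i ∈ range n, a i ^ 2) with hs
  have hs0 : 0 ≤ s := Real.sqrt_nonneg _
  have hss : s ^ 2 = ∑ i ∈ range n, a i ^ 2 := Real.sq_sqrt (sum_nonneg fun i _ => sq_nonneg _)
  rcases hs0.eq_or_lt with h | h
  · rw [← h]; simp; positivity
  have m2 := rX_moment2 a n
  have m4 := rX_moment4 a n
  rw [← hss] at m2 m4
  have key : ∀ x : ℝ, s ^ 2 * x ^ 2 - x ^ 4 / 4 ≤ s ^ 3 * |x| := by
    intro x
    have h1 : x ^ 2 = |x| ^ 2 := (sq_abs x).symm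
    have h2 : x ^ 4 = |x| ^ 4 := by
      rw [show (4:ℕ) = 2 * 2 by norm_num, pow_mul, pow_mul, sq_abs]
    rw [h1, h2]
    have hx := abs_nonneg x
    generalize |x| = u at hx
    have : 0 ≤ s ^ 3 - s ^ 2 * u + u ^ 3 / 4 := by
      nlinarith [mul_nonneg (add_nonneg hx hs0) (sq_nonneg (u - s)), mul_nonneg hx (sq_nonneg (u - s)), mul_nonneg hs0 (sq_nonneg (u - s)), pow_pos h 3, mul_nonneg hs0 (sq_nonneg (2*u - 3*s)), mul_nonneg hx (sq_nonneg (2*u - 3*s)), mul_nonneg hs0 (sq_nonneg (7*u - 8*s)), mul_nonneg hx (sq_nonneg (7*u - 8*s)), pow_nonneg hx 3]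
    nlinarith
  have := sum_le_sum fun A (_ : A ∈ (range n).powerset) => key (rX a n A)
  rw [sum_sub_distrib, ← mul_sum, ← mul_sum, ← sum_div, m2] at this
  have h3 : 0 < s ^ 3 := by positivity
  refine le_of_mul_le_mul_left ?_ h3
  nlinarith

lemma sqrt_sum_bound (t : ℝ) (ht : 0 ≤ t) (N : ℕ) :
    ∑ r ∈ range N, (if √((r:ℝ)+1) < t then 1 / √((r:ℝ)+1) else 0) ≤ 2 * min (√(N:ℝ)) t := by
  induction N with
  | zero => simp [ht]
  | succ N ih =>
    rw [sum_range_succ]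
    push_cast
    have hmono : √(N:ℝ) ≤ √((N:ℝ)+1) := Real.sqrt_le_sqrt (by linarith)
    split_ifs with h
    · rw [min_eq_left h.le]
      have h1 : min (√(N:ℝ)) t ≤ √(N:ℝ) := min_le_left _ _
      have hp : 0 < √((N:ℝ)+1) := Real.sqrt_pos.2 (by positivity)
      have e1 := Real.sq_sqrt (show (0:ℝ) ≤ N by positivity)
      have e2 := Real.sq_sqrt (show (0:ℝ) ≤ (N:ℝ)+1 by positivity)
      have : 1 / √((N:ℝ)+1) ≤ 2 * √((N:ℝ)+1) - 2 * √(N:ℝ) := by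
        rw [div_le_iff₀ hp]
        nlinarith [sq_nonneg (√((N:ℝ)+1) - √(N:ℝ))]
      linarith
    · have := min_le_min_right t hmono
      linarith

lemma sum_shift (n i : ℕ) (h : ℕ → ℝ) :
    ∑ k : Fin (n+1), h ((i + k) % (n+1)) = ∑ r ∈ range (n+1), h r := by
  rw [Finset.sum_range, ← Equiv.sum_comp (Equiv.addLeft (Fin.ofNat (n+1) i)) (fun r : Fin (n+1) => h r)]
  refine sum_congr rfl fun k _ => ?_
  simp [Fin.val_add]

lemma sum_shift' (n k : ℕ) (h : ℕ → ℝ) :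
    ∑ i ∈ range (n+1), h ((i + k) % (n+1)) = ∑ r ∈ range (n+1), h r := by
  rw [Finset.sum_range, ← sum_shift n k h]
  simp [add_comm]

def ca (n i k : ℕ) : ℝ := 1 / (√((n:ℝ)+1) * √((((i + k) % (n+1) : ℕ) : ℝ) + 1))

lemma ca_nonneg (n i k : ℕ) : 0 ≤ ca n i k := by unfold ca; positivity

lemma excess (n i : ℕ) (y Y : ℝ) (hY : 0 < Y) :
    ∑ k : Fin (n+1), (if Y / ((n:ℝ)+1) < |y| * ca n i k then |y| * ca n i k else 0)
      ≤ 2 * y ^ 2 / Y := by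
  set q := √((n:ℝ)+1) with hq
  have hq0 : 0 < q := Real.sqrt_pos.2 (by positivity)
  have hqq : q ^ 2 = (n:ℝ)+1 := Real.sq_sqrt (by positivity)
  have h := sqrt_sum_bound (|y| * q / Y) (by positivity) (n+1)
  rw [← sum_shift n i (fun r => if √((r:ℝ)+1) < |y| * q / Y then 1 / √((r:ℝ)+1) else 0)] at h
  have h2 := mul_le_mul_of_nonneg_left (h.trans (mul_le_mul_of_nonneg_left (min_le_right _ _) (by norm_num : (0:ℝ) ≤ 2))) (show 0 ≤ |y| / q by positivity)
  rw [mul_sum] at h2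
  refine le_of_eq_of_le (sum_congr rfl fun k _ => ?_) (h2.trans_eq ?_)
  · have hp : 0 < √((((i + k) % (n+1) : ℕ) : ℝ) + 1) := Real.sqrt_pos.2 (by positivity)
    unfold ca
    rw [← hq, ← hqq, mul_ite, mul_zero]
    generalize √((((i + k) % (n+1) : ℕ) : ℝ) + 1) = p at hp
    have : Y / q ^ 2 < |y| * (1 / (q * p)) ↔ p < |y| * q / Y := by
      rw [mul_one_div, div_lt_div_iff₀ (by positivity) (by positivity), lt_div_iff₀ hY]
      constructor
      · intro h; exact lt_of_mul_lt_mul_left (by linarith : q * (p * Y) < q * (|y| * q)) hq0.le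
      · intro h; have := mul_lt_mul_of_pos_left h hq0; linarith
    simp only [this]
    congr 1
    field_simp
  · rw [← sq_abs y]; field_simp

lemma core_point (n i : ℕ) (w Y B a x : ℝ) (hY : 0 < Y) (hB : 0 ≤ B) (ha : 0 ≤ a) (hx : |x| ≤ B) :
    w * (a * x) ≤ Y / ((n:ℝ)+1) * |x| + (if Y / ((n:ℝ)+1) < |w| * a then |w| * a else 0) * B := by
  have h2 : w * (a * x) ≤ |w| * a * |x| := by
    refine (le_abs_self _).trans_eq ?_
    rw [abs_mul, abs_mul, abs_of_nonneg ha, mul_assoc]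
  refine h2.trans ?_
  split_ifs with hlt
  · have : 0 ≤ Y / ((n:ℝ)+1) * |x| := by positivity
    have := mul_le_mul_of_nonneg_left hx (show 0 ≤ |w| * a by positivity)
    linarith
  · have := mul_le_mul_of_nonneg_right (not_lt.1 hlt) (abs_nonneg x)
    linarith

lemma core_step (n i : ℕ) (x : Fin (n+1) → ℝ) (w Y B : ℝ) (hY : 0 < Y) (hB : 0 ≤ B)
    (hx : ∀ k, |x k| ≤ B) (hw : w = ∑ k : Fin (n+1), ca n i k * x k) :
    w ^ 2 ≤ ∑ k : Fin (n+1), Y / ((n:ℝ)+1) * |x k| + 2 * w ^ 2 / Y * B := by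
  have h1 : w ^ 2 = ∑ k : Fin (n+1), w * (ca n i k * x k) := by
    rw [← mul_sum, sq, ← hw]
  have h2 := mul_le_mul_of_nonneg_right (excess n i w Y hY) hB
  rw [sum_mul] at h2
  have h3 := sum_le_sum fun k (_ : k ∈ (univ : Finset (Fin (n+1)))) =>
    core_point n i w Y B (ca n i k) (x k) hY hB (ca_nonneg n i k) (hx k)
  rw [← h1, sum_add_distrib] at h3
  linarith

lemma core (n : ℕ) (x : ℕ → Fin (n+1) → ℝ) (B : ℝ) (hB : 0 ≤ B)
    (hx : ∀ k, ∑ i ∈ range (n+1), |x i k| ≤ B) :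
    √(∑ i ∈ range (n+1), (∑ k : Fin (n+1), ca n i k * x i k) ^ 2) ≤ 3 * B := by
  set y : ℕ → ℝ := fun i => ∑ k : Fin (n+1), ca n i k * x i k with hy
  set Y := √(∑ i ∈ range (n+1), y i ^ 2) with hYd
  change Y ≤ _
  have hY0 : 0 ≤ Y := Real.sqrt_nonneg _
  have hYY : Y ^ 2 = ∑ i ∈ range (n+1), y i ^ 2 := Real.sq_sqrt (sum_nonneg fun i _ => sq_nonneg _)
  rcases hY0.eq_or_lt with h | h
  · rw [← h]; positivity
  have hN : (0:ℝ) < (n:ℝ)+1 := by positivity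
  have step : ∀ i ∈ range (n+1), y i ^ 2 ≤
      ∑ k : Fin (n+1), Y / ((n:ℝ)+1) * |x i k| + 2 * y i ^ 2 / Y * B := by
    intro i hi
    refine core_step n i (x i) (y i) Y B h hB (fun k => ?_) rfl
    exact (single_le_sum (f := fun i => |x i k|) (fun _ _ => abs_nonneg _) hi).trans (hx k)
  have tot := sum_le_sum step
  rw [← hYY, sum_add_distrib, ← sum_mul, ← sum_div, ← mul_sum, ← hYY, sum_comm] at tot
  have h3 : ∑ k : Fin (n+1), ∑ i ∈ range (n+1), Y / ((n:ℝ)+1) * |x i k| ≤ Y * B := by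
    calc _ ≤ ∑ k : Fin (n+1), Y / ((n:ℝ)+1) * B := sum_le_sum fun k _ => by
            rw [← mul_sum]; exact mul_le_mul_of_nonneg_left (hx k) (by positivity)
      _ = Y * B := by simp; field_simp
  have h4 : 2 * Y ^ 2 / Y * B = 2 * Y * B := by field_simp
  have : Y * Y ≤ Y * (3 * B) := by nlinarith
  exact le_of_mul_le_mul_left this h

abbrev L1 : Type := ↥(lp (fun _ : ℕ => ℝ) 1)
abbrev L2 : Type := ↥(lp (fun _ : ℕ => ℝ) 2)

lemma l1_sum_le (x : L1) (s : Finset ℕ) : ∑ i ∈ s, |x i| ≤ ‖x‖ := by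
  have := lp.sum_rpow_le_norm_rpow (p := 1) (by simp) x s
  simpa using this

lemma l2_tendsto (y : L2) :
    Tendsto (fun n : ℕ => √(∑ i ∈ range n, (y i) ^ 2)) atTop (𝓝 ‖y‖) := by
  have h := lp.hasSum_norm (p := 2) (by simp) y
  simp only [ENNReal.toReal_ofNat, Real.rpow_ofNat, Real.norm_eq_abs, sq_abs] at h
  have h2 := (Real.continuous_sqrt.tendsto _).comp h.tendsto_sum_nat
  rwa [Real.sqrt_sq (norm_nonneg _)] at h2

section Weak
variable {E F : Type} [NormedAddCommGroup E] [NormedSpace ℝ E]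
  [NormedAddCommGroup F] [NormedSpace ℝ F]

lemma sum_le_weakNorm_one {n : ℕ} (e : Fin n → E) (f : StrongDual ℝ E) (hf : ‖f‖ ≤ 1) :
    ∑ i, |f (e i)| ≤ weakNorm 1 e := by
  have hb : BddAbove (Set.range fun f : {f : StrongDual ℝ E // ‖f‖ ≤ 1} =>
      (∑ i, ‖(f : StrongDual ℝ E) (e i)‖ ^ (1:ℝ)) ^ (1 / (1:ℝ))) := by
    refine ⟨∑ i, ‖e i‖, ?_⟩
    rintro _ ⟨g, rfl⟩
    simp only [Real.rpow_one, div_one]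
    exact sum_le_sum fun i _ => (g.1.le_opNorm _).trans
      (mul_le_of_le_one_left (norm_nonneg _) g.2)
  have := le_ciSup hb ⟨f, hf⟩
  simpa [weakNorm] using this

lemma weakNorm_one_single_le (e : E) : weakNorm 1 (fun _ : Fin 1 => e) ≤ ‖e‖ := by
  have : Nonempty {f : StrongDual ℝ E // ‖f‖ ≤ 1} := ⟨⟨0, by simp⟩⟩
  refine ciSup_le fun g => ?_
  simp only [Real.rpow_one, div_one, univ_unique, sum_const, card_singleton, one_smul]
  exact (g.1.le_opNorm _).trans (mul_le_of_le_one_left (norm_nonneg _) g.2)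

lemma norm_le_pNorm (T : E →L[ℝ] F) (hT : IsPSumming 1 T) : ‖T‖ ≤ pNorm 1 T := by
  refine le_csInf hT ?_
  rintro C ⟨hC, h⟩
  refine T.opNorm_le_bound hC fun e => ?_
  have := h 1 (fun _ => e)
  simp only [Real.rpow_one, div_one, univ_unique, sum_const, card_singleton, one_smul] at this
  exact this.trans (mul_le_mul_of_nonneg_left (weakNorm_one_single_le e) hC)
end Weak

lemma weakNorm_two_le {K : Type} [TopologicalSpace K] [CompactSpace K] {n : ℕ}
    (v : Fin n → C(K, ℝ)) (hv : ∀ t, ∑ i, (v i t) ^ 2 ≤ 1) : weakNorm 2 v ≤ 1 := by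
  have : Nonempty {f : StrongDual ℝ C(K, ℝ) // ‖f‖ ≤ 1} :=
    ⟨⟨0, (norm_zero (E := StrongDual ℝ C(K, ℝ))).le.trans zero_le_one⟩⟩
  refine ciSup_le fun g => ?_
  rw [← Real.sqrt_eq_rpow]
  simp only [Real.rpow_ofNat, Real.norm_eq_abs, sq_abs]
  set s := √(∑ i, (g.1 (v i)) ^ 2) with hs
  have hs0 : 0 ≤ s := Real.sqrt_nonneg _
  have hss : s ^ 2 = ∑ i, (g.1 (v i)) ^ 2 := Real.sq_sqrt (sum_nonneg fun i _ => sq_nonneg _)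
  have h1 : s ^ 2 = g.1 (∑ i, g.1 (v i) • v i) := by
    rw [hss, map_sum]
    exact sum_congr rfl fun i _ => by rw [map_smul, smul_eq_mul, sq]
  have h2 : ‖∑ i, g.1 (v i) • v i‖ ≤ s := by
    rw [ContinuousMap.norm_le _ hs0]
    intro t
    simp only [ContinuousMap.coe_sum, Finset.sum_apply, ContinuousMap.coe_smul, Pi.smul_apply,
      smul_eq_mul]
    refine Real.abs_le_sqrt ?_
    refine (sum_mul_sq_le_sq_mul_sq _ _ _).trans ?_
    exact mul_le_of_le_one_right (sum_nonneg fun i _ => sq_nonneg _) (hv t)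
  have h3 : s ^ 2 ≤ s := by
    rw [h1]
    exact (le_abs_self _).trans ((g.1.le_opNorm _).trans
      ((mul_le_of_le_one_left (norm_nonneg _) g.2).trans h2))
  nlinarith

/-- Diagonal operators from `ℓ₁` to `ℓ₂` are 1-summing. -/
lemma diag_summing (R : L1 →L[ℝ] L2) (d : ℕ → ℝ) (hd : ∀ x i, R x i = d i * x i) :
    IsPSumming 1 R := by
  have hdb : ∀ i, |d i| ≤ ‖R‖ := fun i => by
    have h1 := lp.norm_apply_le_norm (p := 2) (by simp) (R (lp.single 1 i (1:ℝ))) i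
    rw [hd, lp.single_apply_self, mul_one] at h1
    refine h1.trans ((R.le_opNorm _).trans_eq ?_)
    rw [lp.norm_single (by simp)]; simp
  set D := ‖R‖ + 1 with hD
  have hD0 : 0 < D := by positivity
  refine ⟨4 * D, by positivity, fun L e => ?_⟩
  simp only [Real.rpow_one, div_one]
  refine le_of_tendsto (tendsto_finsetSum _ fun j _ => l2_tendsto (R (e j)))
    (Eventually.of_forall fun n => ?_)
  have hA : ∀ A : Finset ℕ, ∑ j, |rX (fun i => R (e j) i) n A| ≤ D * weakNorm 1 e := by
    intro A
    let l : L1 →ₗ[ℝ] ℝ :=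
      { toFun := fun x => ∑ i ∈ range n, sg A i * (d i / D) * x i
        map_add' := fun x y => by
          rw [← sum_add_distrib]
          exact sum_congr rfl fun i _ => by rw [lp.coeFn_add, Pi.add_apply]; ring
        map_smul' := fun c x => by
          rw [RingHom.id_apply, smul_eq_mul, mul_sum]
          exact sum_congr rfl fun i _ => by
            rw [lp.coeFn_smul, Pi.smul_apply, smul_eq_mul]; ring }
    have hl : ∀ x, ‖l x‖ ≤ 1 * ‖x‖ := by
      intro x
      rw [one_mul]
      refine (abs_sum_le_sum_abs _ _).trans (le_trans (sum_le_sum fun i _ => ?_) (l1_sum_le x (range n)))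
      rw [abs_mul, abs_mul, sg_abs, one_mul, abs_div, abs_of_pos hD0]
      refine mul_le_of_le_one_left (abs_nonneg _) ?_
      rw [div_le_one hD0]
      linarith [hdb i]
    have := sum_le_weakNorm_one e (l.mkContinuous 1 hl) (l.mkContinuous_norm_le zero_le_one hl)
    refine le_trans (le_of_eq ?_) (mul_le_mul_of_nonneg_left this hD0.le)
    rw [mul_sum]
    refine sum_congr rfl fun j _ => ?_
    have hDa : ∀ u : ℝ, D * |u| = |D * u| := fun u => by rw [abs_mul, abs_of_pos hD0]
    rw [hDa]
    congr 1
    change _ = D * ∑ i ∈ range n, sg A i * (d i / D) * (e j) i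
    rw [mul_sum, rX]
    exact sum_congr rfl fun i _ => by rw [hd]; field_simp
  have hk := sum_le_sum fun j (_ : j ∈ univ) => khinchine (fun i => R (e j) i) n
  rw [← mul_sum, ← mul_sum, sum_comm] at hk
  have hs := sum_le_sum fun A (_ : A ∈ (range n).powerset) => hA A
  simp only [sum_const, card_powerset, card_range, nsmul_eq_mul, Nat.cast_pow, Nat.cast_ofNat] at hs
  have h2 : (0:ℝ) < 2 ^ n := by positivity
  refine le_of_mul_le_mul_left ?_ h2
  nlinarith

section Op
variable {K : Type} [TopologicalSpace K] [CompactSpace K]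

def phi (n : ℕ) (p : Fin (n+1) → K) (i : ℕ) : C(K, L1) →L[ℝ] ℝ :=
  ∑ k : Fin (n+1), ca n i k •
    ((lp.evalCLM ℝ (fun _ : ℕ => ℝ) 1 i).comp (ContinuousMap.evalCLM ℝ (p k)))

lemma phi_apply (n : ℕ) (p : Fin (n+1) → K) (i : ℕ) (z : C(K, L1)) :
    phi n p i z = ∑ k : Fin (n+1), ca n i k * z (p k) i := by
  simp only [phi, _root_.sum_apply]
  rfl

def Tm (n : ℕ) (p : Fin (n+1) → K) : C(K, L1) →L[ℝ] L2 :=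
  ∑ i ∈ range (n+1), (phi n p i).smulRight (lp.single 2 i (1:ℝ))

lemma Tm_eq (n : ℕ) (p : Fin (n+1) → K) (z : C(K, L1)) :
    Tm n p z = ∑ i ∈ range (n+1), lp.single 2 i (phi n p i z) := by
  simp only [Tm, _root_.sum_apply, ContinuousLinearMap.smulRight_apply]
  refine sum_congr rfl fun i _ => ?_
  rw [← lp.single_smul]; simp

lemma Tm_apply (n : ℕ) (p : Fin (n+1) → K) (z : C(K, L1)) (j : ℕ) :
    Tm n p z j = if j < n + 1 then ∑ k : Fin (n+1), ca n j k * z (p k) j else 0 := by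
  rw [Tm_eq, lp.coeFn_sum, Finset.sum_apply, ← phi_apply]
  simp [lp.single_apply, Pi.single_apply]

lemma Tm_norm (n : ℕ) (p : Fin (n+1) → K) : ‖Tm n p‖ ≤ 3 := by
  refine ContinuousLinearMap.opNorm_le_bound _ (by norm_num) fun z => ?_
  have h := lp.norm_sum_single (p := 2) (by simp) (fun i => phi n p i z) (range (n+1))
  rw [← Tm_eq] at h
  simp only [ENNReal.toReal_ofNat, Real.rpow_ofNat, Real.norm_eq_abs, sq_abs] at h
  rw [← Real.sqrt_sq (norm_nonneg (Tm n p z)), h]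
  simp only [phi_apply]
  exact core n (fun i k => z (p k) i) ‖z‖ (norm_nonneg _) fun k =>
    (l1_sum_le (z (p k)) _).trans (z.norm_coe_le_norm _)

def Tfull (M : ℕ → ℕ) (p : (m : ℕ) → Fin (M m + 1) → K) : C(K, L1) →L[ℝ] L2 :=
  ∑' m : ℕ, (1/2:ℝ) ^ m • Tm (M m) (p m)

lemma T_summable (M : ℕ → ℕ) (p : (m : ℕ) → Fin (M m + 1) → K) :
    Summable fun m : ℕ => (1/2:ℝ) ^ m • Tm (M m) (p m) := by
  refine Summable.of_norm_bounded (g := fun m => (1/2:ℝ) ^ m * 3)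
    (summable_geometric_two.mul_right 3) fun m => ?_
  rw [norm_smul, norm_pow]
  have := Tm_norm (M m) (p m)
  gcongr
  norm_num

lemma T_hasSum (M : ℕ → ℕ) (p : (m : ℕ) → Fin (M m + 1) → K) (z : C(K, L1)) (j : ℕ) :
    HasSum (fun m : ℕ => (1/2:ℝ) ^ m *
      (if j < M m + 1 then ∑ k : Fin (M m + 1), ca (M m) j k * z (p m k) j else 0))
      (Tfull M p z j) := by
  have h := (T_summable M p).hasSum
  have h2 := h.mapL ((lp.evalCLM ℝ (fun _ : ℕ => ℝ) 2 j).comp (ContinuousLinearMap.apply ℝ L2 z))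
  simp only [← Tm_apply]
  exact h2

def tens (f : C(K, ℝ)) : L1 →L[ℝ] C(K, L1) :=
  LinearMap.mkContinuous
    { toFun := fun y => cmSmul f y
      map_add' := fun x y => by ext1 t; simp [cmSmul]
      map_smul' := fun c x => by ext1 t; exact smul_comm (f t) c x } ‖f‖
    (fun y => by
      refine (ContinuousMap.norm_le _ (by positivity)).2 fun t => ?_
      change ‖f t • y‖ ≤ _
      rw [norm_smul]
      exact mul_le_mul_of_nonneg_right (f.norm_coe_le_norm t) (norm_nonneg _))

lemma tens_apply (f : C(K, ℝ)) (y : L1) : tens f y = cmSmul f y := rfl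

def Sfull (M : ℕ → ℕ) (p : (m : ℕ) → Fin (M m + 1) → K) (f : C(K, ℝ)) : L1 →L[ℝ] L2 :=
  (Tfull M p).comp (tens f)

lemma S_hasSum (M : ℕ → ℕ) (p : (m : ℕ) → Fin (M m + 1) → K) (f : C(K, ℝ)) (y : L1) (j : ℕ) :
    HasSum (fun m : ℕ => (1/2:ℝ) ^ m *
      (if j < M m + 1 then ∑ k : Fin (M m + 1), ca (M m) j k * f (p m k) else 0) * y j)
      (Sfull M p f y j) := by
  have h := T_hasSum M p (tens f y) j
  suffices e : ∀ m, (1/2:ℝ) ^ m *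
      (if j < M m + 1 then ∑ k : Fin (M m + 1), ca (M m) j k * f (p m k) else 0) * y j
      = (1/2:ℝ) ^ m * (if j < M m + 1 then
        ∑ k : Fin (M m + 1), ca (M m) j k * (tens f y) (p m k) j else 0) by
    simp only [e]; exact h
  intro m
  rw [mul_assoc, ite_mul, zero_mul, sum_mul]
  congr 2
  refine sum_congr rfl fun k _ => ?_
  rw [mul_assoc]
  rfl

lemma S_summing (M : ℕ → ℕ) (p : (m : ℕ) → Fin (M m + 1) → K) (f : C(K, ℝ)) :
    IsPSumming 1 (Sfull M p f) := by
  refine diag_summing _ (fun j => Sfull M p f (lp.single 1 j (1:ℝ)) j) fun x i => ?_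
  have h1 := S_hasSum M p f (lp.single 1 i (1:ℝ)) i
  rw [lp.single_apply_self] at h1
  have h2 := h1.mul_right (x i)
  simp only [mul_one] at h2
  exact (S_hasSum M p f x i).unique h2

lemma S_lower (M : ℕ → ℕ) (p : (m : ℕ) → Fin (M m + 1) → K) (f : C(K, ℝ)) (hf : ∀ t, 0 ≤ f t)
    (m j : ℕ) (hj : j < M m + 1) :
    (1/2:ℝ) ^ m * ∑ k : Fin (M m + 1), ca (M m) j k * f (p m k) ≤ ‖Sfull M p f‖ := by
  have h1 := S_hasSum M p f (lp.single 1 j (1:ℝ)) j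
  rw [lp.single_apply_self] at h1
  have h2 := le_hasSum h1 m fun m' _ => by
    have : 0 ≤ ∑ k : Fin (M m' + 1), ca (M m') j k * f (p m' k) :=
      sum_nonneg fun k _ => mul_nonneg (ca_nonneg _ _ _) (hf _)
    split_ifs <;> positivity
  rw [if_pos hj, mul_one] at h2
  refine h2.trans ((le_abs_self _).trans ?_)
  have h3 := lp.norm_apply_le_norm (p := 2) (by simp) (Sfull M p f (lp.single 1 j (1:ℝ))) j
  refine h3.trans (((Sfull M p f).le_opNorm _).trans_eq ?_)
  rw [lp.norm_single (by simp)]; simp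
end Op

def harm (n : ℕ) : ℝ := ∑ r ∈ range (n+1), 1 / ((r:ℝ) + 1)

lemma harm_pos (n : ℕ) : 0 < harm n := sum_pos (fun r _ => by positivity) (by simp)

lemma exists_harm (B : ℝ) : ∃ n, B ≤ harm n := by
  have h := Real.tendsto_sum_range_one_div_nat_succ_atTop
  have h2 := (h.comp (tendsto_add_atTop_nat 1)).eventually_ge_atTop B
  exact h2.exists

def Fv (n i k : ℕ) : ℝ := 1 / (√(harm n) * √((((i + k) % (n+1) : ℕ) : ℝ) + 1))

lemma Fv_nonneg (n i k : ℕ) : 0 ≤ Fv n i k := by unfold Fv; positivity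

lemma Fv_sq (n k : ℕ) : ∑ i : Fin (n+1), Fv n i k ^ 2 = 1 := by
  have h := sum_shift' n k (fun r => 1 / (harm n * ((r:ℝ) + 1)))
  rw [Finset.sum_range] at h
  have hp := harm_pos n
  calc _ = _ := sum_congr rfl fun i _ => by
        unfold Fv
        rw [div_pow, mul_pow, Real.sq_sqrt hp.le, Real.sq_sqrt (by positivity), one_pow]
    _ = _ := h
    _ = (1 / harm n) * harm n := by
        rw [show harm n = ∑ r ∈ range (n+1), 1 / ((r:ℝ) + 1) from rfl, mul_sum]
        exact sum_congr rfl fun r _ => by rw [one_div_mul_one_div]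
    _ = 1 := by field_simp

lemma ca_Fv (n i : ℕ) :
    ∑ k : Fin (n+1), ca n i k * Fv n i k = √(harm n) / √((n:ℝ)+1) := by
  have h := sum_shift n i (fun r => 1 / (√((n:ℝ)+1) * √(harm n)) * (1 / ((r:ℝ) + 1)))
  have hp := harm_pos n
  calc _ = _ := sum_congr rfl fun i _ => by
        unfold Fv ca
        rw [one_div_mul_one_div, one_div_mul_one_div, mul_mul_mul_comm, Real.mul_self_sqrt (by positivity)]
    _ = _ := h
    _ = 1 / (√((n:ℝ)+1) * √(harm n)) * harm n := by
        rw [← mul_sum, harm]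
    _ = _ := by
        have h1 : 0 < √(harm n) := Real.sqrt_pos.2 hp
        have h2 : 0 < √((n:ℝ)+1) := Real.sqrt_pos.2 (by positivity)
        have h3 : √(harm n) * √(harm n) = harm n := Real.mul_self_sqrt hp.le
        field_simp
        rw [sq, h3]

end Helpers

/-- Theorem 12: there exist a compact Hausdorff space `K` and a bounded linear
operator `T : C(K, ℓ₁) → ℓ₂` for which the induced operator `T# : C(K) → L(ℓ₁, ℓ₂)`
(the map `S` with `(S f) y = T (f ⊗ y)`) is not 2-summing: each `T# f` is 1-summing, but
`T# : C(K) → Π₁(ℓ₁, ℓ₂)` fails to be 2-summing — indeed it fails to be 2-summing even when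
its values are measured in the (smaller) operator norm. -/
theorem statement17 :
    ∃ (K : Type) (_ : TopologicalSpace K) (_ : CompactSpace K) (_ : T2Space K)
      (T : C(K, ↥(lp (fun _ : ℕ => ℝ) 1)) →L[ℝ] ↥(lp (fun _ : ℕ => ℝ) 2))
      (S : C(K, ℝ) → (↥(lp (fun _ : ℕ => ℝ) 1) →L[ℝ] ↥(lp (fun _ : ℕ => ℝ) 2))),
      (∀ f y, S f y = T (cmSmul f y)) ∧
      (∀ f, IsPSumming 1 (S f)) ∧
      ¬ (∃ C, 0 ≤ C ∧ ∀ (n : ℕ) (v : Fin n → C(K, ℝ)),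
          (∑ i, ‖S (v i)‖ ^ (2 : ℝ)) ^ ((1 : ℝ) / 2) ≤ C * weakNorm 2 v) ∧
      ¬ (∃ C, 0 ≤ C ∧ ∀ (n : ℕ) (v : Fin n → C(K, ℝ)),
          (∑ i, pNorm 1 (S (v i)) ^ (2 : ℝ)) ^ ((1 : ℝ) / 2) ≤ C * weakNorm 2 v) := by
  choose M hM using fun m : ℕ => exists_harm ((16:ℝ) ^ m)
  let K : Type := (m : ℕ) → Fin (M m + 1)
  let p : (m : ℕ) → Fin (M m + 1) → K := fun m k => Function.update 0 m k
  let v : (m : ℕ) → Fin (M m + 1) → C(K, ℝ) := fun m i =>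
    ⟨fun t => Fv (M m) i (t m), (continuous_of_discreteTopology
      (f := fun k : Fin (M m + 1) => Fv (M m) i k)).comp (continuous_apply m)⟩
  have hv0 : ∀ m i t, 0 ≤ v m i t := fun m i t => Fv_nonneg _ _ _
  have hvw : ∀ m, weakNorm 2 (v m) ≤ 1 := fun m => weakNorm_two_le _ fun t => (Fv_sq (M m) (t m)).le
  have hlow : ∀ m i, (1/2:ℝ) ^ m * (√(harm (M m)) / √((M m:ℝ)+1)) ≤ ‖Sfull M p (v m i)‖ := by
    intro m i
    have h := S_lower M p (v m i) (hv0 m i) m i i.2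
    rw [← ca_Fv (M m) i]
    refine le_of_eq_of_le ?_ h
    congr 1
    refine Finset.sum_congr rfl fun k _ => ?_
    simp [v, p]
  have hbig : ∀ m, (2:ℝ) ^ m ≤ (∑ i, ‖Sfull M p (v m i)‖ ^ (2 : ℝ)) ^ ((1 : ℝ) / 2) := by
    intro m
    rw [← Real.sqrt_eq_rpow]
    refine Real.le_sqrt_of_sq_le ?_
    simp only [Real.rpow_ofNat]
    have h1 : ∀ i ∈ (Finset.univ : Finset (Fin (M m + 1))),
        ((1/2:ℝ) ^ m) ^ 2 * (harm (M m) / ((M m:ℝ)+1)) ≤ ‖Sfull M p (v m i)‖ ^ 2 := by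
      intro i _
      have h2 := pow_le_pow_left₀ (by positivity) (hlow m i) 2
      rwa [mul_pow, div_pow (√_), Real.sq_sqrt (harm_pos _).le, Real.sq_sqrt (by positivity)] at h2
    refine le_trans ?_ (Finset.sum_le_sum h1)
    rw [Finset.sum_const, Finset.card_univ, Fintype.card_fin, nsmul_eq_mul]
    have h3 : (((M m + 1 : ℕ) : ℝ)) * (((1/2:ℝ) ^ m) ^ 2 * (harm (M m) / ((M m:ℝ)+1)))
        = ((1/2:ℝ) ^ m) ^ 2 * harm (M m) := by
      push_cast; field_simp
    rw [h3]
    refine le_trans (le_of_eq ?_) (mul_le_mul_of_nonneg_left (hM m) (by positivity))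
    rw [← pow_mul, ← pow_mul, mul_comm m 2, pow_mul, pow_mul, ← mul_pow]
    norm_num
  have hfin : ¬ ∃ C : ℝ, 0 ≤ C ∧ ∀ (n : ℕ) (v : Fin n → C(K, ℝ)),
      (∑ i, ‖Sfull M p (v i)‖ ^ (2 : ℝ)) ^ ((1 : ℝ) / 2) ≤ C * weakNorm 2 v := by
    rintro ⟨C, hC, h⟩
    obtain ⟨m, hm⟩ := pow_unbounded_of_one_lt C (one_lt_two : (1:ℝ) < 2)
    have := (hbig m).trans ((h _ (v m)).trans (mul_le_of_le_one_right hC (hvw m)))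
    linarith
  refine ⟨K, inferInstance, inferInstance, inferInstance, Tfull M p, Sfull M p,
    fun f y => rfl, S_summing M p, hfin, ?_⟩
  rintro ⟨C, hC, h⟩
  refine hfin ⟨C, hC, fun n v => le_trans ?_ (h n v)⟩
  refine Real.rpow_le_rpow (Finset.sum_nonneg fun i _ => by positivity) ?_ (by norm_num)
  exact Finset.sum_le_sum fun i _ => Real.rpow_le_rpow (norm_nonneg _)
    (norm_le_pNorm _ (S_summing M p (v i))) (by norm_num)
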